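/- Let a, b, γ, x be nonzero complex numbers with (ab;q)_n ≠ 0 for all n ≥ 0. Then, as the real parameter ε tends to 0 from above (so that |q·γε/(a/ε)| < 1 for all sufficiently small ε and the left-hand side is defined), the Askey-Wilson q-Bessel function J_{γε}(−x/ε; a/ε; bε|q) tends to the big q-Bessel function J_{qγ/b}(x/a; ab; q) = ₁φ₁(−a/x; ab; q, q·γ·x). -/

import Mathlib

open Filter Topology

/-- The q-shifted factorial `(a;q)_n = ∏_{j=0}^{n-1} (1 - a q^j)`. -/
noncomputable def qPoch (a q : ℂ) (n : ℕ) : ℂ := ∏ j ∈ Finset.range n, (1 - a * q ^ j)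

/-- The Askey-Wilson q-Bessel function
`J_γ(x;a;b|q) = ∑ (ax;q)_n (a/x;q)_n / ((ab;q)_n (q;q)_n) (-qγ/a)^n`. -/
noncomputable def awQBessel (q a b γ x : ℂ) : ℂ :=
  ∑' n : ℕ, qPoch (a * x) q n * qPoch (a / x) q n /
    (qPoch (a * b) q n * qPoch q q n) * (-(q * γ / a)) ^ n

/-- The big q-Bessel function
`J_γ(x;a;q) = ∑ (-1/x;q)_n (-1)^n q^{n(n-1)/2} / ((a;q)_n (q;q)_n) (aγx)^n`. -/
noncomputable def bigQBessel (q a γ x : ℂ) : ℂ :=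
  ∑' n : ℕ, qPoch (-1 / x) q n * (-1) ^ n * q ^ (n * (n - 1) / 2) /
    (qPoch a q n * qPoch q q n) * (a * γ * x) ^ n

/-- The basic hypergeometric series
`₁φ₁(α;β;q,z) = ∑_{n≥0} (α;q)_n (-1)^n q^{n(n-1)/2} / ((β;q)_n (q;q)_n) z^n`. -/
noncomputable def phi11 (q α β z : ℂ) : ℂ :=
  ∑' n : ℕ, qPoch α q n * (-1) ^ n * q ^ (n * (n - 1) / 2) /
    (qPoch β q n * qPoch q q n) * z ^ n

lemma prod_neg_mul_pow (q z : ℂ) (n : ℕ) :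
    ∏ j ∈ Finset.range n, (0 - z * q ^ j) = (-1) ^ n * q ^ (n * (n - 1) / 2) * z ^ n := by
  rw [← Finset.sum_range_id, ← Finset.prod_pow_eq_pow_sum]
  simp only [zero_sub, neg_eq_neg_one_mul (z * _), Finset.prod_mul_distrib, Finset.prod_const,
    Finset.card_range]
  ring

lemma qPoch_div_mul_pow (q u t : ℂ) (ht : t ≠ 0) (n : ℕ) :
    qPoch (u / t) q n * t ^ n = ∏ j ∈ Finset.range n, (t - u * q ^ j) := by
  have h : t ^ n = ∏ _j ∈ Finset.range n, t := by simp
  rw [h, qPoch, ← Finset.prod_mul_distrib]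
  refine Finset.prod_congr rfl fun j _ => ?_
  field_simp

lemma norm_qPoch_le (q : ℝ) (hq0 : 0 < q) (α : ℂ) (n : ℕ) :
    ‖qPoch α q n‖ ≤ ∏ j ∈ Finset.range n, (1 + ‖α‖ * q ^ j) := by
  rw [qPoch, norm_prod]
  refine Finset.prod_le_prod (fun _ _ => norm_nonneg _) fun j _ => ?_
  refine (norm_sub_le _ _).trans (le_of_eq ?_)
  simp [abs_of_pos hq0]

lemma one_sub_mul_pow_ne_zero_of_qPoch_ne_zero {β q : ℂ} (h : ∀ n, qPoch β q n ≠ 0) (n : ℕ) :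
    1 - β * q ^ n ≠ 0 :=
  Finset.prod_ne_zero_iff.1 (h (n + 1)) n (Finset.self_mem_range_succ n)

lemma qPoch_self_ne_zero (q : ℝ) (hq0 : 0 < q) (hq1 : q < 1) (n : ℕ) :
    qPoch (q : ℂ) q n ≠ 0 := by
  refine Finset.prod_ne_zero_iff.2 fun j _ h => ?_
  have h1 : q * q ^ j < 1 := by
    rw [← pow_succ']
    exact pow_lt_one₀ hq0.le hq1 (Nat.succ_ne_zero j)
  have h2 : (q : ℂ) * q ^ j = 1 := (sub_eq_zero.1 h).symm
  exact h1.ne (mod_cast h2)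

lemma summable_qPoch_majorant (q : ℝ) (hq0 : 0 < q) (hq1 : q < 1) (α β z : ℂ)
    (hβ : ∀ n, qPoch β q n ≠ 0) :
    Summable fun n : ℕ => (∏ j ∈ Finset.range n, (1 + ‖α‖ * q ^ j)) *
      (∏ j ∈ Finset.range n, (1 / 2 + ‖z‖ * q ^ j)) / ‖qPoch β q n * qPoch q q n‖ := by
  have hqq := qPoch_self_ne_zero q hq0 hq1
  have hpos : ∀ c : ℝ, 0 < c → ∀ w : ℂ, ∀ j : ℕ, 0 < c + ‖w‖ * q ^ j := fun c hc w j => by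
    positivity
  refine summable_of_ratio_test_tendsto_lt_one (l := 1 / 2) (by norm_num)
    (Eventually.of_forall fun n => ?_) ?_
  · exact div_ne_zero (mul_ne_zero (Finset.prod_pos fun j _ => hpos 1 one_pos α j).ne'
      (Finset.prod_pos fun j _ => hpos (1 / 2) (by norm_num) z j).ne')
      (norm_ne_zero_iff.2 (mul_ne_zero (hβ n) (hqq n)))
  · have hq : Tendsto (fun n : ℕ => q ^ n) atTop (𝓝 0) :=
      tendsto_pow_atTop_nhds_zero_of_lt_one hq0.le hq1
    have hqc : Tendsto (fun n : ℕ => (q : ℂ) ^ n) atTop (𝓝 0) :=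
      tendsto_pow_atTop_nhds_zero_of_norm_lt_one (by simpa [abs_of_pos hq0] using hq1)
    have hden : ∀ w : ℂ, Tendsto (fun n : ℕ => ‖1 - w * (q : ℂ) ^ n‖) atTop (𝓝 1) := fun w => by
      simpa using ((hqc.const_mul w).const_sub 1).norm
    have hlim : Tendsto (fun n : ℕ => (1 + ‖α‖ * q ^ n) * (1 / 2 + ‖z‖ * q ^ n) /
        (‖1 - β * (q : ℂ) ^ n‖ * ‖1 - (q : ℂ) * (q : ℂ) ^ n‖)) atTop (𝓝 (1 / 2)) := by
      have h := (((hq.const_mul ‖α‖).const_add 1).mul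
        ((hq.const_mul ‖z‖).const_add (1 / 2))).div ((hden β).mul (hden q)) (by norm_num)
      simp only [mul_zero, add_zero, mul_one, one_mul, div_one] at h
      exact h
    refine hlim.congr fun n => ?_
    have h1 := (Finset.prod_pos fun j (_ : j ∈ Finset.range n) => hpos 1 one_pos α j)
    have h2 := (Finset.prod_pos fun j (_ : j ∈ Finset.range n) => hpos (1 / 2) (by norm_num) z j)
    have h3 := norm_pos_iff.2 (hβ n)
    have h4 := norm_pos_iff.2 (hqq n)
    have h5 := norm_pos_iff.2 (one_sub_mul_pow_ne_zero_of_qPoch_ne_zero hβ n)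
    have h6 := norm_pos_iff.2 (one_sub_mul_pow_ne_zero_of_qPoch_ne_zero hqq n)
    have hs : ∀ w : ℂ, qPoch w q (n + 1) = qPoch w q n * (1 - w * (q : ℂ) ^ n) := fun w =>
      Finset.prod_range_succ _ _
    have hnn : ∀ m : ℕ, 0 ≤ (∏ j ∈ Finset.range m, (1 + ‖α‖ * q ^ j)) *
        (∏ j ∈ Finset.range m, (1 / 2 + ‖z‖ * q ^ j)) / ‖qPoch β q m * qPoch q q m‖ := fun m =>
      div_nonneg (mul_nonneg (Finset.prod_nonneg fun j _ => (hpos 1 one_pos α j).le)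
        (Finset.prod_nonneg fun j _ => (hpos (1 / 2) (by norm_num) z j).le)) (norm_nonneg _)
    rw [Real.norm_of_nonneg (hnn _), Real.norm_of_nonneg (hnn _), Finset.prod_range_succ,
      Finset.prod_range_succ, hs, hs]
    simp only [norm_mul]
    generalize (∏ j ∈ Finset.range n, (1 + ‖α‖ * q ^ j)) = A at *
    generalize (∏ j ∈ Finset.range n, (1 / 2 + ‖z‖ * q ^ j)) = B at *
    generalize ‖qPoch β q n‖ = C at *
    generalize ‖qPoch (q : ℂ) q n‖ = D at *
    generalize ‖1 - β * (q : ℂ) ^ n‖ = E at *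
    generalize ‖1 - (q : ℂ) * (q : ℂ) ^ n‖ = F at *
    field_simp

/-- `₁φ₁` is the limit of the series obtained by replacing `∏ (-z q^j)` by `∏ (t - z q^j)`. -/
lemma tendsto_tsum_phi11 (q : ℝ) (hq0 : 0 < q) (hq1 : q < 1) (α β z : ℂ)
    (hβ : ∀ n, qPoch β q n ≠ 0) :
    Tendsto (fun t : ℂ => ∑' n : ℕ, qPoch α q n * (∏ j ∈ Finset.range n, (t - z * (q : ℂ) ^ j)) /
      (qPoch β q n * qPoch q q n)) (𝓝 0) (𝓝 (phi11 q α β z)) := by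
  refine tendsto_tsum_of_dominated_convergence (summable_qPoch_majorant q hq0 hq1 α β z hβ)
    (fun n => ?_) ?_
  · have hc : Continuous fun t : ℂ => qPoch α q n *
        (∏ j ∈ Finset.range n, (t - z * (q : ℂ) ^ j)) / (qPoch β q n * qPoch q q n) := by
      fun_prop
    convert hc.tendsto 0 using 2
    rw [prod_neg_mul_pow]
    ring
  · filter_upwards [Metric.closedBall_mem_nhds (0 : ℂ) (by norm_num : (0 : ℝ) < 1 / 2)] with t ht n
    rw [norm_div, norm_mul, norm_prod]
    have ht' : ‖t‖ ≤ 1 / 2 := by simpa using ht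
    gcongr
    · exact norm_qPoch_le q hq0 α n
    · refine (norm_sub_le _ _).trans ?_
      simpa [abs_of_pos hq0] using ht'

lemma bigQBessel_eq_phi11 (q a b γ x : ℂ) (ha : a ≠ 0) (hb : b ≠ 0) :
    bigQBessel q (a * b) (q * γ / b) (x / a) = phi11 q (-(a / x)) (a * b) (q * γ * x) := by
  have h1 : -1 / (x / a) = -(a / x) := by rw [div_div_eq_mul_div]; ring
  have h2 : a * b * (q * γ / b) * (x / a) = q * γ * x := by field_simp
  simp only [bigQBessel, phi11, h1, h2]

theorem awQBessel_to_bigQBessel (q : ℝ) (hq0 : 0 < q) (hq1 : q < 1)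
    (a b γ x : ℂ) (ha : a ≠ 0) (hb : b ≠ 0) (hγ : γ ≠ 0) (hx : x ≠ 0)
    (hab : ∀ n : ℕ, qPoch (a * b) (q : ℂ) n ≠ 0) :
    Tendsto (fun ε : ℝ =>
          awQBessel (q : ℂ) (a / (ε : ℂ)) (b * (ε : ℂ)) (γ * (ε : ℂ)) (-(x / (ε : ℂ))))
        (𝓝[>] (0 : ℝ)) (𝓝 (bigQBessel (q : ℂ) (a * b) ((q : ℂ) * γ / b) (x / a))) ∧
      bigQBessel (q : ℂ) (a * b) ((q : ℂ) * γ / b) (x / a) =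
        phi11 (q : ℂ) (-(a / x)) (a * b) ((q : ℂ) * γ * x) := by
  have hbig := bigQBessel_eq_phi11 q a b γ x ha hb
  refine ⟨?_, hbig⟩
  rw [hbig]
  have ht : Tendsto (fun ε : ℝ => -((q : ℂ) * γ * (ε : ℂ) ^ 2 / a)) (𝓝[>] 0) (𝓝 0) := by
    have hc : Continuous fun ε : ℝ => -((q : ℂ) * γ * (ε : ℂ) ^ 2 / a) := by fun_prop
    simpa using (hc.tendsto 0).mono_left nhdsWithin_le_nhds
  refine ((tendsto_tsum_phi11 q hq0 hq1 (-(a / x)) (a * b) (q * γ * x) hab).comp ht).congr' ?_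
  filter_upwards [self_mem_nhdsWithin] with ε hε
  have hε0 : (ε : ℂ) ≠ 0 := Complex.ofReal_ne_zero.2 (ne_of_gt hε)
  have hqc : (q : ℂ) ≠ 0 := Complex.ofReal_ne_zero.2 hq0.ne'
  have h1 : a / (ε : ℂ) * -(x / ε) = q * γ * x / -(q * γ * (ε : ℂ) ^ 2 / a) := by field_simp
  have h2 : a / (ε : ℂ) / -(x / ε) = -(a / x) := by field_simp
  have h3 : a / (ε : ℂ) * (b * ε) = a * b := by field_simp
  have h4 : -((q : ℂ) * (γ * ε) / (a / ε)) = -(q * γ * (ε : ℂ) ^ 2 / a) := by field_simp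
  have h0 : -((q : ℂ) * γ * (ε : ℂ) ^ 2 / a) ≠ 0 :=
    neg_ne_zero.2 (div_ne_zero (mul_ne_zero (mul_ne_zero hqc hγ) (pow_ne_zero 2 hε0)) ha)
  simp only [Function.comp_apply, awQBessel, h1, h2, h3, h4]
  refine tsum_congr fun n => ?_
  rw [← qPoch_div_mul_pow _ _ _ h0]
  ring
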